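/- N(Γ(2)) = 4: the set of cosets P·SL₂(ℤ) in SL₂(ℝ)/SL₂(ℤ) such that P⁻¹·A·P has integer entries for every A ∈ Γ(2) has exactly 4 elements. -/

import Mathlib

open Matrix MatrixGroups CongruenceSubgroup

/-- A real 2×2 matrix has integer entries. -/
def IsIntegerMatrix (M : Matrix (Fin 2) (Fin 2) ℝ) : Prop :=
  ∀ i j, ∃ k : ℤ, M i j = (k : ℝ)

/-- The embedding `SL(2, ℤ) →* SL(2, ℝ)`. -/
noncomputable def toSL2R : SL(2, ℤ) →* SL(2, ℝ) :=
  Matrix.SpecialLinearGroup.map (Int.castRingHom ℝ)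

/-- `SL(2, ℤ)` as a subgroup of `SL(2, ℝ)`. -/
noncomputable def SL2ZinR : Subgroup SL(2, ℝ) := toSL2R.range

/-- The set of cosets `P·SL₂(ℤ)` in `SL₂(ℝ)/SL₂(ℤ)` such that `P⁻¹·A·P` has integer
entries for every `A ∈ G`; its cardinality is `N(G)`. -/
noncomputable def goodCosets (G : Subgroup SL(2, ℤ)) : Set (SL(2, ℝ) ⧸ SL2ZinR) :=
  {x | ∃ P : SL(2, ℝ), x = QuotientGroup.mk P ∧ ∀ A ∈ G,
    IsIntegerMatrix ((P⁻¹ * toSL2R A * P : SL(2, ℝ)) : Matrix (Fin 2) (Fin 2) ℝ)}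

lemma toSL2R_apply (A : SL(2, ℤ)) (i j : Fin 2) : toSL2R A i j = (A i j : ℝ) := rfl

lemma isIntegerMatrix_toSL2R (A : SL(2, ℤ)) :
    IsIntegerMatrix (toSL2R A : Matrix (Fin 2) (Fin 2) ℝ) :=
  fun i j => ⟨A i j, toSL2R_apply A i j⟩

lemma IsIntegerMatrix.mul {M N : Matrix (Fin 2) (Fin 2) ℝ} (hM : IsIntegerMatrix M)
    (hN : IsIntegerMatrix N) : IsIntegerMatrix (M * N) := by
  intro i j
  choose f hf using hM
  choose g hg using hN
  exact ⟨f i 0 * g 0 j + f i 1 * g 1 j, by simp [Matrix.mul_apply, Fin.sum_univ_two, hf, hg]⟩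

lemma mem_SL2ZinR_iff (P : SL(2, ℝ)) :
    P ∈ SL2ZinR ↔ IsIntegerMatrix (P : Matrix (Fin 2) (Fin 2) ℝ) := by
  constructor
  · rintro ⟨A, rfl⟩
    exact isIntegerMatrix_toSL2R A
  · intro h
    choose f hf using h
    have hdet : (Matrix.of f).det = 1 := by
      have h1 := P.det_coe
      rw [Matrix.det_fin_two] at h1 ⊢
      simp only [hf] at h1
      simp only [Matrix.of_apply]
      exact_mod_cast h1
    refine ⟨⟨Matrix.of f, hdet⟩, ?_⟩
    ext i j
    exact (hf i j).symm

lemma mk_eq_mk_iff (P Q : SL(2, ℝ)) :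
    (QuotientGroup.mk P : SL(2, ℝ) ⧸ SL2ZinR) = QuotientGroup.mk Q ↔
      IsIntegerMatrix ((P⁻¹ * Q : SL(2, ℝ)) : Matrix (Fin 2) (Fin 2) ℝ) := by
  rw [QuotientGroup.eq, mem_SL2ZinR_iff]

/-- The conjugate `P⁻¹·A·P` has integer entries for every `A ∈ Γ(2)`. -/
def ConjugatesGammaTwo (P : SL(2, ℝ)) : Prop :=
  ∀ A ∈ Gamma 2, IsIntegerMatrix ((P⁻¹ * toSL2R A * P : SL(2, ℝ)) : Matrix (Fin 2) (Fin 2) ℝ)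

lemma ConjugatesGammaTwo.mul_toSL2R {P : SL(2, ℝ)} (hP : ConjugatesGammaTwo P) (g : SL(2, ℤ)) :
    ConjugatesGammaTwo (P * toSL2R g) := by
  intro A hA
  have h : (P * toSL2R g)⁻¹ * toSL2R A * (P * toSL2R g) =
      toSL2R g⁻¹ * (P⁻¹ * toSL2R A * P) * toSL2R g := by
    rw [map_inv]; group
  rw [h, Matrix.SpecialLinearGroup.coe_mul, Matrix.SpecialLinearGroup.coe_mul]
  exact ((isIntegerMatrix_toSL2R _).mul (hP A hA)).mul (isIntegerMatrix_toSL2R _)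

/-- The square of the standard upper unipotent generator. -/
def upperTwo : SL(2, ℤ) := ⟨!![1, 2; 0, 1], by simp⟩

/-- The square of the standard lower unipotent generator. -/
def lowerTwo : SL(2, ℤ) := ⟨!![1, 0; 2, 1], by simp⟩

lemma upperTwo_mem : upperTwo ∈ Gamma 2 := by
  rw [Gamma_mem]; simp [upperTwo]; decide

lemma lowerTwo_mem : lowerTwo ∈ Gamma 2 := by
  rw [Gamma_mem]; simp [lowerTwo]; decide

lemma conj_eq (P : SL(2, ℝ)) (A : SL(2, ℤ)) :
    ((P⁻¹ * toSL2R A * P : SL(2, ℝ)) : Matrix (Fin 2) (Fin 2) ℝ) =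
      !![P 1 1, -P 0 1; -P 1 0, P 0 0] * !![(A 0 0 : ℝ), A 0 1; A 1 0, A 1 1] *
        !![P 0 0, P 0 1; P 1 0, P 1 1] := by
  rw [Matrix.SpecialLinearGroup.coe_mul, Matrix.SpecialLinearGroup.coe_mul, Matrix.SpecialLinearGroup.coe_inv,
    Matrix.adjugate_fin_two]
  congr 1
  · congr 1
    ext i j
    fin_cases i <;> fin_cases j <;> rfl
  · exact Matrix.eta_fin_two _

lemma ConjugatesGammaTwo.lower_row {P : SL(2, ℝ)} (hP : ConjugatesGammaTwo P) :
    ∃ m n : ℤ, 2 * P 1 0 ^ 2 = (m : ℝ) ∧ 2 * P 1 0 * P 1 1 = (n : ℝ) := by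
  have h := hP _ upperTwo_mem
  have hdet := P.det_coe
  rw [Matrix.det_fin_two] at hdet
  rw [conj_eq] at h
  obtain ⟨m, hm⟩ := h 1 0
  obtain ⟨n, hn⟩ := h 0 0
  simp [upperTwo, Matrix.mul_apply, Fin.sum_univ_two] at hm hn
  refine ⟨-m, n - 1, ?_, ?_⟩ <;> push_cast <;> linarith

lemma exists_mul_toSL2R_lower_eq_zero {P : SL(2, ℝ)} (hP : ConjugatesGammaTwo P) :
    ∃ g : SL(2, ℤ), (P * toSL2R g) 1 0 = 0 := by
  by_cases hr : P 1 0 = 0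
  · exact ⟨1, by simpa using hr⟩
  obtain ⟨m, n, hm, hn⟩ := hP.lower_row
  have hm0 : m ≠ 0 := by
    rintro rfl
    simp [hr] at hm
  have hg : (0 : ℕ) < Int.gcd n m := Int.gcd_pos_of_ne_zero_right _ hm0
  obtain ⟨n', m', hco, hn', hm'⟩ := Int.exists_gcd_one hg
  have hco' : IsCoprime n' (-m') := (Int.isCoprime_iff_gcd_eq_one.mpr hco).neg_right
  obtain ⟨g, hg0, hg1⟩ := hco'.exists_SL2_col 0
  refine ⟨g, ?_⟩
  have hgR : (Int.gcd n m : ℝ) ≠ 0 := by exact_mod_cast hg.ne'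
  have hnR : (n : ℝ) = n' * (Int.gcd n m : ℝ) := by exact_mod_cast congrArg (Int.cast (R := ℝ)) hn'
  have hmR : (m : ℝ) = m' * (Int.gcd n m : ℝ) := by exact_mod_cast congrArg (Int.cast (R := ℝ)) hm'
  rw [Matrix.SpecialLinearGroup.coe_mul, Matrix.mul_apply, Fin.sum_univ_two, toSL2R_apply, toSL2R_apply,
    hg0, hg1]
  push_cast
  apply mul_right_cancel₀ hgR
  linear_combination -P 1 0 * (hn + hnR) + P 1 1 * (hm + hmR)

/-- The matrix `!![p, q; 0, p⁻¹]`. -/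
noncomputable def upperTriangular (p q : ℝ) (hp : p ≠ 0) : SL(2, ℝ) :=
  ⟨!![p, q; 0, p⁻¹], by simp [hp]⟩

lemma exists_mul_toSL2R_eq_upperTriangular {P : SL(2, ℝ)} (hP : ConjugatesGammaTwo P) :
    ∃ (g : SL(2, ℤ)) (p q : ℝ) (hp : 0 < p), P * toSL2R g = upperTriangular p q hp.ne' := by
  obtain ⟨g, hg⟩ := exists_mul_toSL2R_lower_eq_zero hP
  have key : ∀ Q : SL(2, ℝ), Q 1 0 = 0 → 0 < Q 0 0 →
      ∃ (p q : ℝ) (hp : 0 < p), Q = upperTriangular p q hp.ne' := by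
    intro Q h0 hpos
    have hdet := Q.det_coe
    rw [Matrix.det_fin_two, h0, mul_zero, sub_zero] at hdet
    refine ⟨Q 0 0, Q 0 1, hpos, ?_⟩
    ext i j
    fin_cases i <;> fin_cases j
    · rfl
    · rfl
    · exact h0
    · exact eq_inv_of_mul_eq_one_right hdet
  have hne : (P * toSL2R g) 0 0 ≠ 0 := by
    intro h
    have hdet := (P * toSL2R g).det_coe
    rw [Matrix.det_fin_two, hg, h] at hdet
    simp at hdet
  rcases hne.lt_or_gt with h | h
  · refine ⟨g * -1, key _ ?_ ?_⟩
    all_goals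
      have hneg : P * toSL2R (g * -1) = -(P * toSL2R g) := by
        ext i j
        simp [toSL2R, Matrix.mul_apply]
      rw [hneg, Matrix.SpecialLinearGroup.coe_neg, Matrix.neg_apply]
    · simpa using hg
    · linarith
  · exact ⟨g, key _ hg h⟩

lemma mk_upperTriangular_eq_iff {p q p' q' : ℝ} (hp : p ≠ 0) (hp' : p' ≠ 0) :
    (QuotientGroup.mk (upperTriangular p q hp) : SL(2, ℝ) ⧸ SL2ZinR) =
      QuotientGroup.mk (upperTriangular p' q' hp') ↔
    (∃ k : ℤ, p' = k * p) ∧ (∃ k : ℤ, q' / p - q / p' = k) ∧ ∃ k : ℤ, p = k * p' := by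
  have h : ((upperTriangular p q hp)⁻¹ * upperTriangular p' q' hp' : SL(2, ℝ)) =
      !![p' / p, q' / p - q / p'; 0, p / p'] := by
    rw [Matrix.SpecialLinearGroup.coe_mul, Matrix.SpecialLinearGroup.coe_inv, Matrix.adjugate_fin_two]
    ext i j
    fin_cases i <;> fin_cases j <;> simp [upperTriangular, Matrix.mul_apply] <;> ring
  rw [mk_eq_mk_iff, h]
  simp only [← div_eq_iff hp, ← div_eq_iff hp']
  constructor
  · intro h
    exact ⟨h 0 0, h 0 1, h 1 1⟩
  · rintro ⟨h1, h2, h3⟩ i j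
    fin_cases i <;> fin_cases j
    · exact h1
    · exact h2
    · exact ⟨0, by simp⟩
    · exact h3

lemma conj_upperTriangular (p q : ℝ) (hp : p ≠ 0) (A : SL(2, ℤ)) :
    (((upperTriangular p q hp)⁻¹ * toSL2R A * upperTriangular p q hp : SL(2, ℝ)) :
        Matrix (Fin 2) (Fin 2) ℝ) =
      !![A 0 0 - p * q * A 1 0, q / p * (A 0 0 - A 1 1) + A 0 1 / p ^ 2 - q ^ 2 * A 1 0;
        p ^ 2 * A 1 0, p * q * A 1 0 + A 1 1] := by
  rw [conj_eq]
  ext i j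
  fin_cases i <;> fin_cases j <;> simp [upperTriangular, Matrix.mul_apply] <;> field_simp <;> ring

lemma ConjugatesGammaTwo.upperTriangular_integrality {p q : ℝ} {hp : p ≠ 0}
    (h : ConjugatesGammaTwo (upperTriangular p q hp)) :
    ∃ m n k l : ℤ, 2 * p ^ 2 = m ∧ 2 / p ^ 2 = (n : ℝ) ∧ 2 * p * q = k ∧ 2 * q ^ 2 = l := by
  have hu := h _ upperTwo_mem
  have hl := h _ lowerTwo_mem
  rw [conj_upperTriangular] at hu hl
  obtain ⟨n, hn⟩ := hu 0 1
  obtain ⟨k, hk⟩ := hl 1 1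
  obtain ⟨m, hm⟩ := hl 1 0
  obtain ⟨l, hl⟩ := hl 0 1
  simp [upperTwo, lowerTwo] at hn hk hm hl
  refine ⟨m, n, k - 1, -l, ?_, hn, ?_, ?_⟩ <;> push_cast <;> linarith

lemma conjugatesGammaTwo_upperTriangular {p q : ℝ} (hp : p ≠ 0) (m n k l j : ℤ)
    (hm : 2 * p ^ 2 = m) (hn : 2 / p ^ 2 = (n : ℝ)) (hk : 2 * p * q = k) (hl : 2 * q ^ 2 = l)
    (hj : 2 * q / p = j) : ConjugatesGammaTwo (upperTriangular p q hp) := by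
  intro A hA
  rw [Gamma_mem] at hA
  obtain ⟨ha, hb, hc, hd⟩ := hA
  have had : ((A 0 0 - A 1 1 : ℤ) : ZMod 2) = 0 := by push_cast; rw [ha, hd, sub_self]
  rw [ZMod.intCast_zmod_eq_zero_iff_dvd] at hb hc had
  obtain ⟨b, hb⟩ := hb
  obtain ⟨c, hc⟩ := hc
  obtain ⟨e, he⟩ := had
  have hbR : (A 0 1 : ℝ) = 2 * b := by exact_mod_cast congrArg (Int.cast (R := ℝ)) hb
  have hcR : (A 1 0 : ℝ) = 2 * c := by exact_mod_cast congrArg (Int.cast (R := ℝ)) hc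
  have heR : (A 0 0 - A 1 1 : ℝ) = 2 * e := by exact_mod_cast congrArg (Int.cast (R := ℝ)) he
  rw [conj_upperTriangular, hbR, hcR, heR]
  intro i j'
  fin_cases i <;> fin_cases j'
  · refine ⟨A 0 0 - k * c, ?_⟩
    simp [← hk]; ring
  · refine ⟨j * e + n * b - l * c, ?_⟩
    simp [← hj, ← hn, ← hl]; ring
  · refine ⟨m * c, ?_⟩
    simp [← hm]; ring
  · refine ⟨k * c + A 1 1, ?_⟩
    simp [← hk]; ring

lemma sqrt_two_ne_zero : √(2 : ℝ) ≠ 0 := by positivity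

/-- The coset of `!![p, q; 0, p⁻¹]`. -/
noncomputable def upperCoset (p q : ℝ) (hp : p ≠ 0) : SL(2, ℝ) ⧸ SL2ZinR :=
  QuotientGroup.mk (upperTriangular p q hp)

lemma upperCoset_mem_of_conjugates {p q : ℝ} (hp : 0 < p)
    (h : ConjugatesGammaTwo (upperTriangular p q hp.ne')) :
    upperCoset p q hp.ne' ∈ ({upperCoset 1 0 one_ne_zero, upperCoset √2 0 sqrt_two_ne_zero,
      upperCoset √2 (√2)⁻¹ sqrt_two_ne_zero,
      upperCoset (√2)⁻¹ 0 (inv_ne_zero sqrt_two_ne_zero)} : Set (SL(2, ℝ) ⧸ SL2ZinR)) := by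
  obtain ⟨m, n, k, l, hm, hn, hk, hl⟩ := h.upperTriangular_integrality
  have hs : √(2 : ℝ) ^ 2 = 2 := Real.sq_sqrt (by norm_num)
  have hmn : m * n = 4 := by
    have : (m * n : ℝ) = 4 := by rw [← hm, ← hn]; field_simp; norm_num
    exact_mod_cast this
  have hm0 : 0 < m := by
    have : (0 : ℝ) < m := by rw [← hm]; positivity
    exact_mod_cast this
  have hm4 : m ≤ 4 := Int.le_of_dvd (by norm_num) ⟨n, hmn.symm⟩
  have hkl : k ^ 2 = m * l := by
    have : (k ^ 2 : ℝ) = m * l := by rw [← hk, ← hm, ← hl]; ring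
    exact_mod_cast this
  have translate : ∀ {p' q' : ℝ} (hp' : p' ≠ 0) (t : ℤ), p = p' → q = q' + t * p' →
      upperCoset p q hp.ne' = upperCoset p' q' hp' := by
    rintro _ q' hp' t rfl rfl
    refine (mk_upperTriangular_eq_iff _ _).2 ⟨⟨1, by simp⟩, ⟨-t, ?_⟩, ⟨1, by simp⟩⟩
    field_simp
    push_cast
    ring
  simp only [Set.mem_insert_iff, Set.mem_singleton_iff]
  interval_cases m
  · right; right; right
    have hpe : p = (√2)⁻¹ := by
      rw [← sq_eq_sq₀ hp.le (by positivity), inv_pow, hs]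
      push_cast at hm
      linarith
    refine translate _ k hpe ?_
    rw [← hk, hpe]
    field_simp
    rw [hs]; ring
  · left
    have hpe : p = 1 := by
      rw [← sq_eq_sq₀ hp.le (by positivity)]
      push_cast at hm
      linarith
    obtain ⟨t, rfl⟩ : 2 ∣ k := Int.prime_two.dvd_of_dvd_pow (n := 2) ⟨l, hkl⟩
    refine translate _ t hpe ?_
    rw [hpe] at hk
    push_cast at hk
    linarith
  · omega
  · have hpe : p = √2 := by
      rw [← sq_eq_sq₀ hp.le (by positivity), hs]
      push_cast at hm
      linarith
    obtain ⟨t, rfl⟩ : 2 ∣ k :=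
      Int.prime_two.dvd_of_dvd_pow (n := 2) (Dvd.dvd.trans (by norm_num) ⟨l, hkl⟩)
    rw [hpe] at hk
    push_cast at hk
    have hq : q = t * (√2)⁻¹ := by
      field_simp
      linarith
    rcases Int.even_or_odd' t with ⟨u, rfl | rfl⟩
    · right; left
      refine translate _ u hpe ?_
      rw [hq]
      push_cast
      field_simp
      linear_combination -u * hs
    · right; right; left
      refine translate _ u hpe ?_
      rw [hq]
      push_cast
      field_simp
      rw [hs]; ring

lemma goodCosets_Gamma_two :
    goodCosets (Gamma 2) = {upperCoset 1 0 one_ne_zero, upperCoset √2 0 sqrt_two_ne_zero,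
      upperCoset √2 (√2)⁻¹ sqrt_two_ne_zero,
      upperCoset (√2)⁻¹ 0 (inv_ne_zero sqrt_two_ne_zero)} := by
  have hs : √(2 : ℝ) ^ 2 = 2 := Real.sq_sqrt (by norm_num)
  ext x
  constructor
  · rintro ⟨P, rfl, hP⟩
    obtain ⟨g, p, q, hp, hg⟩ := exists_mul_toSL2R_eq_upperTriangular hP
    have hx : (QuotientGroup.mk P : SL(2, ℝ) ⧸ SL2ZinR) = upperCoset p q hp.ne' := by
      rw [upperCoset, ← hg]
      exact (QuotientGroup.mk_mul_of_mem P (MonoidHom.mem_range.2 ⟨g, rfl⟩)).symm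
    rw [hx]
    exact upperCoset_mem_of_conjugates hp (hg ▸ ConjugatesGammaTwo.mul_toSL2R hP g)
  · rintro (rfl | rfl | rfl | rfl)
    · exact ⟨_, rfl, conjugatesGammaTwo_upperTriangular _ 2 2 0 0 0 (by norm_num) (by norm_num)
        (by norm_num) (by norm_num) (by norm_num)⟩
    · exact ⟨_, rfl, conjugatesGammaTwo_upperTriangular _ 4 1 0 0 0 (by norm_num) (by norm_num)
        (by norm_num) (by norm_num) (by norm_num)⟩
    · refine ⟨_, rfl, conjugatesGammaTwo_upperTriangular _ 4 1 2 1 1 (by norm_num) (by norm_num)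
        ?_ (by norm_num) ?_⟩
      · field_simp; norm_num
      · field_simp; norm_num
    · exact ⟨_, rfl, conjugatesGammaTwo_upperTriangular _ 1 4 0 0 0 (by norm_num) (by norm_num)
        (by norm_num) (by norm_num) (by norm_num)⟩

lemma int_sq_ne_two (k : ℤ) : (k : ℝ) ^ 2 ≠ 2 := by
  intro h
  have h' : k ^ 2 = 2 := by exact_mod_cast h
  have h1 : k < 2 := by nlinarith
  have h2 : -2 < k := by nlinarith
  interval_cases k <;> omega

lemma two_mul_int_ne_one (k : ℤ) : 2 * (k : ℝ) ≠ 1 := by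
  intro h
  have h' : 2 * k = 1 := by exact_mod_cast h
  omega

/-- `N(Γ(2)) = 4`. -/
theorem stmt_15 : (goodCosets (Gamma 2)).ncard = 4 := by
  have hs : √(2 : ℝ) ^ 2 = 2 := Real.sq_sqrt (by norm_num)
  have sqrt_ne : ∀ k : ℤ, √(2 : ℝ) ≠ k := fun k h => int_sq_ne_two k (by rw [← h, hs])
  rw [goodCosets_Gamma_two, Set.ncard_insert_of_notMem, Set.ncard_insert_of_notMem,
    Set.ncard_insert_of_notMem, Set.ncard_singleton]
  · rw [Set.mem_singleton_iff, upperCoset, upperCoset, mk_upperTriangular_eq_iff]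
    rintro ⟨⟨k, hk⟩, -⟩
    field_simp at hk
    rw [hs] at hk
    exact two_mul_int_ne_one k (by linarith)
  · simp only [Set.mem_insert_iff, Set.mem_singleton_iff, upperCoset, mk_upperTriangular_eq_iff]
    rintro (⟨-, ⟨k, hk⟩, -⟩ | ⟨⟨k, hk⟩, -⟩)
    · field_simp at hk
      rw [hs] at hk
      exact two_mul_int_ne_one k (by linarith)
    · field_simp at hk
      rw [hs] at hk
      exact two_mul_int_ne_one k (by linarith)
  · simp only [Set.mem_insert_iff, Set.mem_singleton_iff, upperCoset, mk_upperTriangular_eq_iff]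
    rintro (⟨⟨k, hk⟩, -⟩ | ⟨⟨k, hk⟩, -⟩ | ⟨-, -, ⟨k, hk⟩⟩)
    · exact sqrt_ne k (by simpa using hk)
    · exact sqrt_ne k (by simpa using hk)
    · field_simp at hk
      exact sqrt_ne k (by simpa using hk)
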